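/- arXiv:2107.10385 — 3 statements merged into one kernel-verified Lean document; each statement's English description precedes it below -/
import Mathlib

section
/- Let N ∈ ℕ, d ∈ {0,…,N} and E ⊆ {0,…,N}. Then L̄_{N,d}(E) ≠ {0,…,N} if and only if E is d-admitting. -/
open MvPolynomial

noncomputable section

namespace CoveringSymmetric

/-- `N = ∑ᵢ (kᵢ - 1)` for the uniform grid `[0,k₁-1] × ⋯ × [0,kₙ-1]`. -/
def Ntot (n : ℕ) (k : Fin n → ℕ) : ℕ := ∑ i, (k i - 1)

/-- The integer points of the uniform grid `G = [0,k₁-1] × ⋯ × [0,kₙ-1]`. -/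
def gridSet (n : ℕ) (k : Fin n → ℕ) : Set (Fin n → ℕ) := {x | ∀ i, x i < k i}

/-- The real point of `ℝⁿ` corresponding to an integer point. -/
def toR {n : ℕ} (x : Fin n → ℕ) : Fin n → ℝ := fun i => (x i : ℝ)

/-- The weight `wt(x) = ∑ᵢ xᵢ` of a point. -/
def wt {n : ℕ} (x : Fin n → ℕ) : ℕ := ∑ i, x i

/-- The weight-determined set `E̲ = {x ∈ G : wt(x) ∈ E}`. -/
def wdSet (n : ℕ) (k : Fin n → ℕ) (E : Finset ℕ) : Set (Fin n → ℕ) :=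
  {x ∈ gridSet n k | wt x ∈ E}

/-- The layer `j̲ = {x ∈ G : wt(x) = j}`. -/
def layer (n : ℕ) (k : Fin n → ℕ) (j : ℕ) : Set (Fin n → ℕ) :=
  {x ∈ gridSet n k | wt x = j}

/-- The grid is strictly unimodal (SU²):
`|0̲| < ⋯ < |⌊N/2⌋̲| = |⌈N/2⌉̲| > ⋯ > |N̲|`. -/
def SU2 (n : ℕ) (k : Fin n → ℕ) : Prop :=
  (∀ j, j < Ntot n k / 2 → (layer n k j).ncard < (layer n k (j + 1)).ncard) ∧
  (layer n k (Ntot n k / 2)).ncard = (layer n k ((Ntot n k + 1) / 2)).ncard ∧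
  (∀ j, (Ntot n k + 1) / 2 ≤ j → j < Ntot n k →
    (layer n k (j + 1)).ncard < (layer n k j).ncard)

/-- The zero set `Z_G(P)` of a polynomial within the grid. -/
def ZG (n : ℕ) (k : Fin n → ℕ) (P : MvPolynomial (Fin n) ℝ) : Set (Fin n → ℕ) :=
  {x ∈ gridSet n k | eval (toR x) P = 0}

/-- The degree-`d` Zariski closure of `S ⊆ G` within the grid. -/
def Zcl (n : ℕ) (k : Fin n → ℕ) (d : ℕ) (S : Set (Fin n → ℕ)) : Set (Fin n → ℕ) :=
  {a ∈ gridSet n k | ∀ P : MvPolynomial (Fin n) ℝ, P.totalDegree ≤ d →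
    (∀ x ∈ S, eval (toR x) P = 0) → eval (toR a) P = 0}

/-- The degree-`d` Z*-closure of a weight-determined set, as a set of weights:
`{j ∈ [0,N] : j̲ ⊆ Z-cl_{G,d}(E̲)}`. -/
def Zstar (n : ℕ) (k : Fin n → ℕ) (d : ℕ) (E : Finset ℕ) : Set ℕ :=
  {j | j ≤ Ntot n k ∧ layer n k j ⊆ Zcl n k d (wdSet n k E)}

/-- `PC_G(E)`: minimum total degree of a nontrivial polynomial cover of `E̲`. -/
def PC (n : ℕ) (k : Fin n → ℕ) (E : Finset ℕ) : ℕ :=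
  sInf {d | ∃ P : MvPolynomial (Fin n) ℝ, P.totalDegree = d ∧
    wdSet n k E ⊆ ZG n k P ∧ ZG n k P ≠ gridSet n k}

/-- `PPC_G(E)`: minimum total degree of a proper polynomial cover of `E̲`. -/
def PPC (n : ℕ) (k : Fin n → ℕ) (E : Finset ℕ) : ℕ :=
  sInf {d | ∃ P : MvPolynomial (Fin n) ℝ, P.totalDegree = d ∧
    wdSet n k E ⊆ ZG n k P ∧
    ∀ j ≤ Ntot n k, j ∉ E → ¬ (layer n k j ⊆ ZG n k P)}

/-- `EPC_G(E)`: minimum total degree of an exact polynomial cover of `E̲`. -/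
def EPC (n : ℕ) (k : Fin n → ℕ) (E : Finset ℕ) : ℕ :=
  sInf {d | ∃ P : MvPolynomial (Fin n) ℝ, P.totalDegree = d ∧ ZG n k P = wdSet n k E}

/-- `x` lies on the affine hyperplane `{y ∈ ℝⁿ : ∑ᵢ wᵢ yᵢ = c}` (with `w ≠ 0`). -/
def onHyp {n : ℕ} (w : Fin n → ℝ) (c : ℝ) (x : Fin n → ℕ) : Prop :=
  ∑ i, w i * (x i : ℝ) = c

/-- `HC_G(E)`: minimum size of a nontrivial hyperplane cover of `E̲`. -/
def HC (n : ℕ) (k : Fin n → ℕ) (E : Finset ℕ) : ℕ :=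
  sInf {m | ∃ (w : Fin m → Fin n → ℝ) (c : Fin m → ℝ), (∀ t, w t ≠ 0) ∧
    (∀ x ∈ wdSet n k E, ∃ t, onHyp (w t) (c t) x) ∧
    ∃ x ∈ gridSet n k, ∀ t, ¬ onHyp (w t) (c t) x}

/-- `PHC_G(E)`: minimum size of a proper hyperplane cover of `E̲`. -/
def PHC (n : ℕ) (k : Fin n → ℕ) (E : Finset ℕ) : ℕ :=
  sInf {m | ∃ (w : Fin m → Fin n → ℝ) (c : Fin m → ℝ), (∀ t, w t ≠ 0) ∧
    (∀ x ∈ wdSet n k E, ∃ t, onHyp (w t) (c t) x) ∧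
    ∀ j ≤ Ntot n k, j ∉ E → ¬ (layer n k j ⊆ {x | ∃ t, onHyp (w t) (c t) x})}

/-- The certifying degree of `S ⊆ G`: least `d ∈ [0,N]` such that some polynomial of
total degree at most `d` is nonconstant on `G` but constant on `S`. -/
def certDeg (n : ℕ) (k : Fin n → ℕ) (S : Set (Fin n → ℕ)) : ℕ :=
  sInf {d | d ≤ Ntot n k ∧ ∃ f : MvPolynomial (Fin n) ℝ, f.totalDegree ≤ d ∧
    (∃ a ∈ gridSet n k, ∃ b ∈ gridSet n k, eval (toR a) f ≠ eval (toR b) f) ∧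
    ∀ a ∈ S, ∀ b ∈ S, eval (toR a) f = eval (toR b) f}

/-- `T_{N,i} = [0,i-1] ∪ [N-i+1,N]` (so `T_{N,0} = ∅`). -/
def T (N i : ℕ) : Finset ℕ := Finset.range i ∪ Finset.Icc (N - i + 1) N

/-- `E` is `(d,i)`-admitting: `E ∪ T_{N,i} ≠ [0,N]` and `|E \ T_{N,i}| ≤ d - i`. -/
def Admitting (N d i : ℕ) (E : Finset ℕ) : Prop :=
  E ∪ T N i ≠ Finset.range (N + 1) ∧ (E \ T N i).card ≤ d - i

/-- `E` is `d`-admitting: `(d,i)`-admitting for some `i ∈ [0,d]`. -/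
def DAdmitting (N d : ℕ) (E : Finset ℕ) : Prop :=
  ∃ i ≤ d, Admitting N d i E

/-- The operator `L_{N,d}`: if `E = {t₁ < ⋯ < t_s}` with `s ≥ d+1`, then
`L_{N,d}(E) = [0, t_{s-d}] ∪ E ∪ [t_{d+1}, N]`, and `L_{N,d}(E) = E` if `s ≤ d`.
(For `E ⊆ [0,N]`, `j ≤ t_{s-d}` iff `E` has at least `d+1` elements `≥ j`, and
`t_{d+1} ≤ j` iff `E` has at least `d+1` elements `≤ j`.) -/
def Lop (N d : ℕ) (E : Finset ℕ) : Finset ℕ :=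
  E ∪ (Finset.range (N + 1)).filter fun j =>
    d + 1 ≤ (E.filter fun t => j ≤ t).card ∨ d + 1 ≤ (E.filter fun t => t ≤ j).card

/-- `L̄_{N,d}(E) = ⋃ₘ L_{N,d}^m(E)`, the union of all iterates of `L_{N,d}` on `E`. -/
def Lbar (N d : ℕ) (E : Finset ℕ) : Set ℕ :=
  ⋃ m : ℕ, ((Lop N d)^[m] E : Set ℕ)

/-- `P` is a (possibly empty) product of polynomials of total degree at most 1. -/
def ProdLinear (n : ℕ) (P : MvPolynomial (Fin n) ℝ) : Prop :=
  ∃ (m : ℕ) (ℓ : Fin m → MvPolynomial (Fin n) ℝ),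
    (∀ t, (ℓ t).totalDegree ≤ 1) ∧ P = ∏ t, ℓ t

/-- The degree-`d` h-closure of `S ⊆ G`. -/
def hcl (n : ℕ) (k : Fin n → ℕ) (d : ℕ) (S : Set (Fin n → ℕ)) : Set (Fin n → ℕ) :=
  {a ∈ gridSet n k | ∀ P : MvPolynomial (Fin n) ℝ, ProdLinear n P → P.totalDegree ≤ d →
    (∀ x ∈ S, eval (toR x) P = 0) → eval (toR a) P = 0}

theorem subset_Lop (N d : ℕ) (E : Finset ℕ) : E ⊆ Lop N d E := Finset.subset_union_left

theorem Lop_subset_range {N d : ℕ} {E : Finset ℕ} (hE : E ⊆ Finset.range (N + 1)) :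
    Lop N d E ⊆ Finset.range (N + 1) :=
  Finset.union_subset hE (Finset.filter_subset _ _)

theorem subset_iterate_Lop (N d : ℕ) (E : Finset ℕ) (m : ℕ) : E ⊆ (Lop N d)^[m] E := by
  induction m with
  | zero => exact subset_rfl
  | succ m ih =>
    rw [Function.iterate_succ_apply']
    exact ih.trans (subset_Lop _ _ _)

theorem iterate_Lop_subset_range {N : ℕ} (d : ℕ) {E : Finset ℕ}
    (hE : E ⊆ Finset.range (N + 1)) (m : ℕ) : (Lop N d)^[m] E ⊆ Finset.range (N + 1) := by
  induction m with
  | zero => exact hE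
  | succ m ih =>
    rw [Function.iterate_succ_apply']
    exact Lop_subset_range ih

/-- The iterates of `Lop` on a subset of `[0,N]` reach a fixed point. -/
theorem exists_Lop_iterate_eq {N : ℕ} (d : ℕ) {E : Finset ℕ} (hE : E ⊆ Finset.range (N + 1)) :
    ∃ m, Lop N d ((Lop N d)^[m] E) = (Lop N d)^[m] E := by
  by_contra! h
  have hcard : ∀ m, m ≤ ((Lop N d)^[m] E).card := by
    intro m
    induction m with
    | zero => exact Nat.zero_le _
    | succ m ih =>
      rw [Function.iterate_succ_apply']
      exact ih.trans_lt <| Finset.card_lt_card <|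
        (subset_Lop N d _).ssubset_of_ne (h m).symm
  have h₁ := hcard (N + 2)
  have h₂ := Finset.card_le_card (iterate_Lop_subset_range d hE (N + 2))
  rw [Finset.card_range] at h₂
  omega

theorem T_subset_range {N i : ℕ} (hi : i ≤ N) : T N i ⊆ Finset.range (N + 1) := by
  intro x hx
  simp only [T, Finset.mem_union, Finset.mem_range, Finset.mem_Icc] at hx ⊢
  omega

theorem Admitting.mono {N d i : ℕ} {E F : Finset ℕ} (hEF : E ⊆ F) (hi : i ≤ N)
    (hF : F ⊆ Finset.range (N + 1)) (h : Admitting N d i F) : Admitting N d i E := by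
  refine ⟨fun hE => h.1 ?_, (Finset.card_le_card (Finset.sdiff_subset_sdiff hEF le_rfl)).trans h.2⟩
  refine (Finset.union_subset hF (T_subset_range hi)).antisymm ?_
  rw [← hE]
  exact Finset.union_subset_union_left hEF

theorem Admitting.Lop_union_T {N d i : ℕ} {E : Finset ℕ} (hi : i ≤ d)
    (hE : E ⊆ Finset.range (N + 1)) (h : Admitting N d i E) :
    Lop N d E ∪ T N i = E ∪ T N i := by
  refine (Finset.union_subset ?_ Finset.subset_union_right).antisymm
    (Finset.union_subset_union_left (subset_Lop N d E))
  intro j hj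
  rcases Finset.mem_union.1 hj with hj | hj
  · exact Finset.mem_union_left _ hj
  by_contra hjT
  have hjT' : j ∉ T N i := fun h' => hjT (Finset.mem_union_right _ h')
  have hcard := h.2
  simp only [Finset.mem_filter, Finset.mem_range] at hj
  simp only [T, Finset.mem_union, Finset.mem_range, Finset.mem_Icc, not_or] at hjT'
  rcases hj.2 with hd | hd
  · have hsub : E.filter (fun t => j ≤ t) ⊆ E \ T N i ∪ Finset.Icc (N - i + 1) N := by
      intro t ht
      have htN := hE (Finset.mem_filter.1 ht).1
      simp only [T, Finset.mem_filter, Finset.mem_union, Finset.mem_sdiff, Finset.mem_range,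
        Finset.mem_Icc] at ht htN ⊢
      by_cases hc : N - i + 1 ≤ t
      · right; omega
      · left; exact ⟨ht.1, by omega⟩
    have h₁ := (Finset.card_le_card hsub).trans (Finset.card_union_le _ _)
    rw [Nat.card_Icc] at h₁
    omega
  · have hsub : E.filter (fun t => t ≤ j) ⊆ E \ T N i ∪ Finset.range i := by
      intro t ht
      simp only [T, Finset.mem_filter, Finset.mem_union, Finset.mem_sdiff, Finset.mem_range,
        Finset.mem_Icc] at ht ⊢
      by_cases hc : t < i
      · right; exact hc
      · left; exact ⟨ht.1, by omega⟩
    have h₁ := (Finset.card_le_card hsub).trans (Finset.card_union_le _ _)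
    rw [Finset.card_range] at h₁
    omega

theorem Admitting.iterate_Lop_union_T {N d i : ℕ} {E : Finset ℕ} (hi : i ≤ d)
    (hE : E ⊆ Finset.range (N + 1)) (h : Admitting N d i E) (m : ℕ) :
    (Lop N d)^[m] E ∪ T N i = E ∪ T N i := by
  induction m with
  | zero => rfl
  | succ m ih =>
    have hm : Admitting N d i ((Lop N d)^[m] E) := by
      refine ⟨ih ▸ h.1, ?_⟩
      rw [← Finset.union_sdiff_right, ih, Finset.union_sdiff_right]
      exact h.2
    rw [Function.iterate_succ_apply', hm.Lop_union_T hi (iterate_Lop_subset_range d hE m), ih]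

theorem card_filter_of_Lop_eq {N d j : ℕ} {F : Finset ℕ} (hfix : Lop N d F = F)
    (hj : j ≤ N) (hjF : j ∉ F) :
    (F.filter fun t => j ≤ t).card ≤ d ∧ (F.filter fun t => t ≤ j).card ≤ d := by
  by_contra hc
  apply hjF
  rw [← hfix]
  refine Finset.mem_union_right _ (Finset.mem_filter.2 ⟨Finset.mem_range.2 (by omega), ?_⟩)
  omega

/-- A proper subset of `[0,N]` fixed by `Lop` is `d`-admitting. -/
theorem dAdmitting_of_Lop_eq {N d : ℕ} {F : Finset ℕ} (hF : F ⊆ Finset.range (N + 1))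
    (hne : F ≠ Finset.range (N + 1)) (hfix : Lop N d F = F) : DAdmitting N d F := by
  obtain ⟨j, hjN, hjF⟩ : ∃ j ∈ Finset.range (N + 1), j ∉ F := by
    by_contra! h
    exact hne (hF.antisymm h)
  rw [Finset.mem_range] at hjN
  have hex : ∃ i, i ∉ F ∨ N - i ∉ F := ⟨j, Or.inl hjF⟩
  set i := Nat.find hex
  have hi : i ∉ F ∨ N - i ∉ F := Nat.find_spec hex
  have hlt : ∀ t < i, t ∈ F ∧ N - t ∈ F := fun t ht => by
    have := Nat.find_min hex ht
    tauto
  have hij : i ≤ j := Nat.find_min' hex (Or.inl hjF)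
  have hiN : i ≤ N - j := Nat.find_min' hex (Or.inr (by rwa [Nat.sub_sub_self (by omega)]))
  have hTF : T N i ⊆ F := by
    intro t ht
    simp only [T, Finset.mem_union, Finset.mem_range, Finset.mem_Icc] at ht
    rcases ht with ht | ht
    · exact (hlt t ht).1
    · have := (hlt (N - t) (by omega)).2
      rwa [Nat.sub_sub_self ht.2] at this
  have key : (F \ T N i).card + i ≤ d := by
    rcases hi with hi | hi
    · have hdisj : Disjoint (F \ T N i) (Finset.Icc (N - i + 1) N) :=
        Finset.disjoint_of_subset_right Finset.subset_union_right Finset.sdiff_disjoint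
      have hsub : F \ T N i ∪ Finset.Icc (N - i + 1) N ⊆ F.filter fun t => i ≤ t := by
        intro t ht
        have hT := @hTF t
        simp only [T, Finset.mem_filter, Finset.mem_union, Finset.mem_sdiff, Finset.mem_range,
          Finset.mem_Icc] at ht hT ⊢
        rcases ht with ht | ht
        · exact ⟨ht.1, by omega⟩
        · exact ⟨hT (Or.inr ht), by omega⟩
      have h₁ := Finset.card_le_card hsub
      rw [Finset.card_union_of_disjoint hdisj, Nat.card_Icc] at h₁
      have h₂ := (card_filter_of_Lop_eq hfix (by omega) hi).1
      omega
    · have hdisj : Disjoint (F \ T N i) (Finset.range i) :=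
        Finset.disjoint_of_subset_right Finset.subset_union_left Finset.sdiff_disjoint
      have hsub : F \ T N i ∪ Finset.range i ⊆ F.filter fun t => t ≤ N - i := by
        intro t ht
        have hT := @hTF t
        have hN := @hF t
        simp only [T, Finset.mem_filter, Finset.mem_union, Finset.mem_sdiff, Finset.mem_range,
          Finset.mem_Icc] at ht hT hN ⊢
        rcases ht with ht | ht
        · have := hN ht.1
          exact ⟨ht.1, by omega⟩
        · exact ⟨hT (Or.inl ht), by omega⟩
      have h₁ := Finset.card_le_card hsub
      rw [Finset.card_union_of_disjoint hdisj, Finset.card_range] at h₁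
      have h₂ := (card_filter_of_Lop_eq hfix (by omega) hi).2
      omega
  refine ⟨i, by omega, ?_, by omega⟩
  rwa [Finset.union_eq_left.2 hTF]

/-- `L̄_{N,d}(E) ≠ [0,N]` iff `E` is `d`-admitting. -/
theorem stmt6 (N d : ℕ) (hd : d ≤ N) (E : Finset ℕ) (hE : E ⊆ Finset.range (N + 1)) :
    Lbar N d E ≠ ↑(Finset.range (N + 1)) ↔ DAdmitting N d E := by
  constructor
  · intro h
    obtain ⟨m, hm⟩ := exists_Lop_iterate_eq d hE
    have hne : (Lop N d)^[m] E ≠ Finset.range (N + 1) := by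
      intro heq
      refine h (Set.Subset.antisymm (Set.iUnion_subset fun k => ?_) ?_)
      · exact Finset.coe_subset.2 (iterate_Lop_subset_range d hE k)
      · rw [← heq]
        exact Set.subset_iUnion (fun k => ((Lop N d)^[k] E : Set ℕ)) m
    have hsub := iterate_Lop_subset_range d hE m
    obtain ⟨i, hi, hadm⟩ := dAdmitting_of_Lop_eq hsub hne hm
    exact ⟨i, hi, hadm.mono (subset_iterate_Lop N d E m) (hi.trans hd) hsub⟩
  · rintro ⟨i, hi, hadm⟩ heq
    refine hadm.1 ((Finset.union_subset hE (T_subset_range (hi.trans hd))).antisymm ?_)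
    intro j hj
    have hj' : j ∈ Lbar N d E := heq ▸ Finset.mem_coe.2 hj
    obtain ⟨m, hm⟩ := Set.mem_iUnion.1 hj'
    rw [← hadm.iterate_Lop_union_T hi hE m]
    exact Finset.mem_union_left _ (Finset.mem_coe.1 hm)

end CoveringSymmetric
end
end

section
/- Let G be a uniform grid and E ⊊ {0,…,N}. Then PPC_G(E) = min{d ∈ {0,…,N} : Z*-cl_{G,d}(E) = E}. -/
open MvPolynomial

noncomputable section

namespace CoveringSymmetric

theorem layer_nonempty (n : ℕ) (k : Fin n → ℕ) (hk : ∀ i, 0 < k i) {j : ℕ}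
    (hj : j ≤ Ntot n k) : (layer n k j).Nonempty := by
  induction j with
  | zero => exact ⟨0, fun i => hk i, by simp [wt]⟩
  | succ j ih =>
    obtain ⟨x, hx, hxj⟩ := ih (by omega)
    have hlt : ∑ i, x i < ∑ i, (k i - 1) := by
      have h : wt x < Ntot n k := by omega
      exact h
    obtain ⟨i, -, hi⟩ := Finset.exists_lt_of_sum_lt hlt
    refine ⟨x + Pi.single i 1, fun t => ?_, ?_⟩
    · have ht := hx t
      by_cases h : t = i
      · subst h
        simp only [Pi.add_apply, Pi.single_eq_same]
        omega
      · simpa [h] using ht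
    · have h : wt (x + Pi.single i 1) = wt x + 1 := by
        simp [wt, Finset.sum_add_distrib]
      rw [h, hxj]

/-- The polynomial `∏_{t ∈ E} (∑ᵢ Xᵢ - t)`. -/
def weightProd (n : ℕ) (E : Finset ℕ) : MvPolynomial (Fin n) ℝ :=
  ∏ t ∈ E, (∑ i, X i - C (t : ℝ))

theorem totalDegree_weightProd_le (n : ℕ) (E : Finset ℕ) :
    (weightProd n E).totalDegree ≤ E.card := by
  refine (totalDegree_finsetProd _ _).trans ?_
  rw [Finset.card_eq_sum_ones]
  refine Finset.sum_le_sum fun t _ => ?_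
  refine (totalDegree_sub_C_le _ _).trans ?_
  refine totalDegree_finsetSum_le fun i _ => ?_
  simp

theorem eval_weightProd_eq_zero_iff {n : ℕ} (E : Finset ℕ) (x : Fin n → ℕ) :
    eval (toR x) (weightProd n E) = 0 ↔ wt x ∈ E := by
  have h : ∀ t : ℕ, (∑ i, (x i : ℝ)) - t = 0 ↔ wt x = t := fun t => by
    rw [sub_eq_zero, wt]
    exact_mod_cast Iff.rfl
  simp [weightProd, Finset.prod_eq_zero_iff, toR, h]

/-- Finitely many polynomials `P j`, each nonzero at its own point `a j`, have a linear
combination that is nonzero at all these points. -/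
theorem exists_pow_combination_eval_ne_zero {n : ℕ} (F : Finset ℕ)
    (P : ℕ → MvPolynomial (Fin n) ℝ) (a : ℕ → Fin n → ℝ)
    (h : ∀ j ∈ F, eval (a j) (P j) ≠ 0) :
    ∃ c : ℝ, ∀ i ∈ F, eval (a i) (∑ j ∈ F, C (c ^ j) * P j) ≠ 0 := by
  let Q : ℕ → Polynomial ℝ := fun i =>
    ∑ j ∈ F, Polynomial.C (eval (a i) (P j)) * Polynomial.X ^ j
  have hQ : ∀ i ∈ F, Q i ≠ 0 := fun i hi h0 => by
    have hc : (Q i).coeff i = eval (a i) (P i) := by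
      simp [Q, Polynomial.finsetSum_coeff, Polynomial.coeff_X_pow, hi]
    exact h i hi (by rw [← hc, h0, Polynomial.coeff_zero])
  obtain ⟨c, hc⟩ := Polynomial.exists_eval_ne_zero_of_natDegree_lt_card (∏ i ∈ F, Q i)
    (Finset.prod_ne_zero_iff.mpr hQ)
    ((Cardinal.natCast_lt_aleph0).trans_le (Cardinal.aleph0_le_mk ℝ))
  rw [Polynomial.eval_prod, Finset.prod_ne_zero_iff] at hc
  refine ⟨c, fun i hi => ?_⟩
  have h_eval : eval (a i) (∑ j ∈ F, C (c ^ j) * P j) = (Q i).eval c := by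
    simp only [Q, map_sum, map_mul, eval_C, Polynomial.eval_finsetSum, Polynomial.eval_mul,
      Polynomial.eval_C, Polynomial.eval_pow, Polynomial.eval_X]
    exact Finset.sum_congr rfl fun j _ => mul_comm _ _
  rw [h_eval]
  exact hc i hi

theorem zstar_eq_iff_exists_proper_cover (n : ℕ) (k : Fin n → ℕ) (d : ℕ) (E : Finset ℕ)
    (hE : E ⊆ Finset.range (Ntot n k + 1)) :
    Zstar n k d E = ↑E ↔ ∃ P : MvPolynomial (Fin n) ℝ, P.totalDegree ≤ d ∧
      wdSet n k E ⊆ ZG n k P ∧ ∀ j ≤ Ntot n k, j ∉ E → ¬ (layer n k j ⊆ ZG n k P) := by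
  constructor
  · intro hZ
    have key : ∀ j, ∃ (P : MvPolynomial (Fin n) ℝ) (a : Fin n → ℕ),
        P.totalDegree ≤ d ∧ (∀ x ∈ wdSet n k E, eval (toR x) P = 0) ∧
        (j ≤ Ntot n k → j ∉ E → a ∈ layer n k j ∧ eval (toR a) P ≠ 0) := by
      intro j
      by_cases hj : j ≤ Ntot n k ∧ j ∉ E
      · have hnot : ¬ layer n k j ⊆ Zcl n k d (wdSet n k E) := fun hsub => by
          have hmem : j ∈ Zstar n k d E := ⟨hj.1, hsub⟩
          rw [hZ] at hmem
          exact hj.2 hmem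
        obtain ⟨a, ha, hna⟩ := Set.not_subset.mp hnot
        have : ∃ P : MvPolynomial (Fin n) ℝ, P.totalDegree ≤ d ∧
            (∀ x ∈ wdSet n k E, eval (toR x) P = 0) ∧ eval (toR a) P ≠ 0 := by
          by_contra! hcon
          exact hna ⟨ha.1, hcon⟩
        obtain ⟨P, hd, h0, hP⟩ := this
        exact ⟨P, a, hd, h0, fun _ _ => ⟨ha, hP⟩⟩
      · exact ⟨0, 0, by simp, by simp, fun h1 h2 => absurd ⟨h1, h2⟩ hj⟩
    choose P a hd h0 hP using key
    have hF : ∀ j ∈ Finset.range (Ntot n k + 1) \ E, j ≤ Ntot n k ∧ j ∉ E := by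
      intro j hj
      simpa [Nat.lt_succ_iff] using hj
    obtain ⟨c, hc⟩ := exists_pow_combination_eval_ne_zero
      (Finset.range (Ntot n k + 1) \ E) P (fun j => toR (a j))
      (fun j hj => (hP j (hF j hj).1 (hF j hj).2).2)
    refine ⟨∑ j ∈ Finset.range (Ntot n k + 1) \ E, C (c ^ j) * P j, ?_,
      fun x hx => ⟨hx.1, ?_⟩, fun j hj hjE hsub => ?_⟩
    · refine totalDegree_finsetSum_le fun j _ => ?_
      rw [← smul_eq_C_mul]
      exact (totalDegree_smul_le _ _).trans (hd j)
    · simp [h0 _ x hx]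
    · exact hc j (by simpa [hjE, Nat.lt_succ_iff] using hj) (hsub (hP j hj hjE).1).2
  · rintro ⟨P, hd, hcov, hprop⟩
    ext j
    constructor
    · rintro ⟨hj, hsub⟩
      by_contra hjE
      exact hprop j hj hjE fun x hx =>
        ⟨hx.1, (hsub hx).2 P hd fun y hy => (hcov hy).2⟩
    · intro hj
      refine ⟨Nat.lt_succ_iff.mp (Finset.mem_range.mp (hE hj)), fun x hx => ⟨hx.1, ?_⟩⟩
      exact fun Q _ hQ => hQ x ⟨hx.1, hx.2.symm ▸ hj⟩

/-- `PPC_G(E) = min{d ∈ [0,N] : Z*-cl_{G,d}(E) = E}`. -/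
theorem stmt11 (n : ℕ) (hn : 1 ≤ n) (k : Fin n → ℕ) (hk : ∀ i, 2 ≤ k i)
    (E : Finset ℕ) (hE : E ⊂ Finset.range (Ntot n k + 1)) :
    PPC n k E = sInf {d | d ≤ Ntot n k ∧ Zstar n k d E = ↑E} := by
  have hcard : E.card ≤ Ntot n k := by
    have := Finset.card_lt_card hE
    rw [Finset.card_range] at this
    omega
  have hW : wdSet n k E ⊆ ZG n k (weightProd n E) ∧
      ∀ j ≤ Ntot n k, j ∉ E → ¬ (layer n k j ⊆ ZG n k (weightProd n E)) := by
    refine ⟨fun x hx => ⟨hx.1, (eval_weightProd_eq_zero_iff E x).mpr hx.2⟩,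
      fun j hj hjE hsub => ?_⟩
    obtain ⟨x, hx⟩ := layer_nonempty n k (fun i => by have := hk i; omega) hj
    exact hjE (hx.2 ▸ (eval_weightProd_eq_zero_iff E x).mp (hsub hx).2)
  have hPPC_le : ∀ Q : MvPolynomial (Fin n) ℝ, (wdSet n k E ⊆ ZG n k Q ∧
      ∀ j ≤ Ntot n k, j ∉ E → ¬ (layer n k j ⊆ ZG n k Q)) → PPC n k E ≤ Q.totalDegree :=
    fun Q hQ => Nat.sInf_le ⟨Q, rfl, hQ⟩
  have hmem : PPC n k E ∈ {d | ∃ P : MvPolynomial (Fin n) ℝ, P.totalDegree = d ∧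
      wdSet n k E ⊆ ZG n k P ∧ ∀ j ≤ Ntot n k, j ∉ E → ¬ (layer n k j ⊆ ZG n k P)} :=
    Nat.sInf_mem ⟨_, weightProd n E, rfl, hW⟩
  have hle : PPC n k E ≤ Ntot n k :=
    ((hPPC_le _ hW).trans (totalDegree_weightProd_le n E)).trans hcard
  obtain ⟨P, hP, hcov⟩ := hmem
  have hB : PPC n k E ∈ {d | d ≤ Ntot n k ∧ Zstar n k d E = ↑E} :=
    ⟨hle, (zstar_eq_iff_exists_proper_cover n k _ E hE.subset).mpr ⟨P, hP.le, hcov⟩⟩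
  refine le_antisymm ?_ (Nat.sInf_le hB)
  obtain ⟨Q, hQ, hQcov⟩ :=
    (zstar_eq_iff_exists_proper_cover n k _ E hE.subset).mp (Nat.sInf_mem ⟨_, hB⟩).2
  exact (hPPC_le Q hQcov).trans hQ

end CoveringSymmetric
end
end

section
/- Let G be an SU² grid and d ∈ {0,…,N}. For every i ∈ {0,…,N}: if i ≤ d then Z*-cl_{G,d}(T_{N,i}) = T_{N,i}, and if i > d then Z*-cl_{G,d}(T_{N,i}) = {0,…,N}. -/
open MvPolynomial

noncomputable section

namespace CoveringSymmetric

/-- The translate `P(X - v)` of a polynomial `P`. -/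
def translate {n : ℕ} (v : Fin n → ℝ) : MvPolynomial (Fin n) ℝ →ₐ[ℝ] MvPolynomial (Fin n) ℝ :=
  aeval fun l => X l - C (v l)

lemma eval_translate {n : ℕ} (v x : Fin n → ℝ) (P : MvPolynomial (Fin n) ℝ) :
    eval x (translate v P) = eval (x - v) P := by
  induction P using MvPolynomial.induction_on with
  | C a => simp [translate]
  | add p q hp hq => simp only [map_add, hp, hq]
  | mul_X p l hp => rw [map_mul, map_mul, map_mul, hp]; simp [translate]

lemma totalDegree_X_sub_C_le {n : ℕ} (l : Fin n) (c : ℝ) :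
    (X l - C c : MvPolynomial (Fin n) ℝ).totalDegree ≤ 1 :=
  (totalDegree_sub_C_le _ _).trans (totalDegree_X l).le

lemma totalDegree_translate_monomial {n : ℕ} (v : Fin n → ℝ) (j : Fin n) (s : Fin n →₀ ℕ) (a : ℝ) :
    (translate v (monomial s a)).totalDegree ≤ (monomial s a).totalDegree ∧
    (X j * (translate v (monomial s a) - monomial s a)).totalDegree
      ≤ (monomial s a).totalDegree := by
  refine MvPolynomial.induction_on_monomial (motive := fun p =>
    (translate v p).totalDegree ≤ p.totalDegree ∧
    (X j * (translate v p - p)).totalDegree ≤ p.totalDegree) (fun a => ?_) (fun p l hp => ?_) s a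
  · simp [translate]
  · obtain ⟨h₁, h₂⟩ := hp
    by_cases hp0 : p = 0
    · simp [hp0]
    have hX : translate v (X l) = X l - C (v l) := by simp [translate]
    have h₃ : (translate v p * (X l - C (v l))).totalDegree ≤ p.totalDegree + 1 :=
      (totalDegree_mul _ _).trans (add_le_add h₁ (totalDegree_X_sub_C_le l _))
    rw [totalDegree_mul_of_isDomain hp0 (X_ne_zero l), totalDegree_X, map_mul, hX]
    refine ⟨h₃, ?_⟩
    have hsplit : X j * (translate v p * (X l - C (v l)) - p * X l)
        = (X j * (translate v p - p)) * X l - C (v l) * (X j * translate v p) := by ring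
    rw [hsplit]
    refine (totalDegree_sub _ _).trans (max_le ?_ ?_)
    · exact (totalDegree_mul _ _).trans (add_le_add h₂ (totalDegree_X l).le)
    · refine (totalDegree_mul _ _).trans ?_
      have := totalDegree_mul (X j) (translate v p)
      rw [totalDegree_X] at this
      rw [totalDegree_C]
      lia

lemma totalDegree_monomial_coeff_le {n : ℕ} (P : MvPolynomial (Fin n) ℝ) {s : Fin n →₀ ℕ}
    (hs : s ∈ P.support) : (monomial s (coeff s P)).totalDegree ≤ P.totalDegree :=
  (totalDegree_monomial_le _ _).trans (le_totalDegree hs)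

lemma totalDegree_translate_le {n : ℕ} (v : Fin n → ℝ) (P : MvPolynomial (Fin n) ℝ) :
    (translate v P).totalDegree ≤ P.totalDegree := by
  rcases isEmpty_or_nonempty (Fin n) with h | ⟨⟨j⟩⟩
  · rw [eq_C_of_isEmpty (translate v P), totalDegree_C]
    exact Nat.zero_le _
  conv_lhs => rw [P.as_sum, map_sum]
  exact totalDegree_finsetSum_le fun s hs =>
    (totalDegree_translate_monomial v j s _).1.trans (totalDegree_monomial_coeff_le P hs)

lemma totalDegree_X_mul_translate_sub_le {n : ℕ} (v : Fin n → ℝ) (j : Fin n)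
    (P : MvPolynomial (Fin n) ℝ) :
    (X j * (translate v P - P)).totalDegree ≤ P.totalDegree := by
  have hsum : X j * (translate v P - P) = ∑ s ∈ P.support,
      X j * (translate v (monomial s (coeff s P)) - monomial s (coeff s P)) := by
    rw [← Finset.mul_sum, Finset.sum_sub_distrib, ← map_sum, ← P.as_sum]
  rw [hsum]
  exact totalDegree_finsetSum_le fun s hs =>
    (totalDegree_translate_monomial v j s _).2.trans (totalDegree_monomial_coeff_le P hs)

lemma totalDegree_translate_sub_le {n : ℕ} (v : Fin n → ℝ) (j : Fin n)
    (P : MvPolynomial (Fin n) ℝ) {d : ℕ} (hP : P.totalDegree ≤ d + 1) :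
    (translate v P - P).totalDegree ≤ d := by
  by_cases h : translate v P - P = 0
  · simp [h]
  have := totalDegree_X_mul_translate_sub_le v j P
  rw [totalDegree_mul_of_isDomain (X_ne_zero j) h, totalDegree_X] at this
  lia

lemma toR_add_single {n : ℕ} (y : Fin n → ℕ) (l : Fin n) :
    toR (y + Pi.single l 1) = toR y + Pi.single l 1 := by
  ext t
  by_cases h : t = l
  · subst h; simp [toR]
  · simp [toR, h]

lemma wt_add_single {n : ℕ} (y : Fin n → ℕ) (l : Fin n) :
    wt (y + Pi.single l 1) = wt y + 1 := by
  simp [wt, Finset.sum_add_distrib]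

lemma exists_eq_add_single {n : ℕ} {y : Fin n → ℕ} {l : Fin n} (h : y l ≠ 0) :
    ∃ z : Fin n → ℕ, y = z + Pi.single l 1 := by
  refine ⟨y - Pi.single l 1, (tsub_add_cancel_of_le fun t => ?_).symm⟩
  by_cases ht : t = l
  · subst ht; simpa using Nat.one_le_iff_ne_zero.2 h
  · simp [ht]

lemma wt_mono {n : ℕ} {x y : Fin n → ℕ} (h : x ≤ y) : wt x ≤ wt y :=
  Finset.sum_le_sum fun l _ => h l

/-- A polynomial of degree at most `d` vanishing on the points of weight at most `d` of a box
vanishes on the whole box. -/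
lemma eval_eq_zero_of_low_layers {n : ℕ} (d : ℕ) : ∀ (m : Fin n → ℕ) (P : MvPolynomial (Fin n) ℝ),
    P.totalDegree ≤ d → (∀ y ≤ m, wt y ≤ d → eval (toR y) P = 0) →
    ∀ y ≤ m, eval (toR y) P = 0 := by
  induction d with
  | zero =>
    intro m P hP h y _
    have h0 := h 0 (zero_le) (by simp [wt])
    rw [totalDegree_eq_zero_iff_eq_C.1 (Nat.le_zero.1 hP)] at h0 ⊢
    simpa using h0
  | succ d ih =>
    intro m P hP h
    suffices H : ∀ w : ℕ, ∀ y ≤ m, wt y = w → eval (toR y) P = 0 from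
      fun y hy => H _ y hy rfl
    intro w
    induction w with
    | zero => exact fun y hy hw => h y hy (by lia)
    | succ w ihw =>
      intro y hy hw
      obtain ⟨l, -, hl⟩ : ∃ l ∈ Finset.univ, y l ≠ 0 :=
        Finset.exists_ne_zero_of_sum_ne_zero (by rw [wt] at hw; lia)
      obtain ⟨z, rfl⟩ := exists_eq_add_single hl
      obtain ⟨m', rfl⟩ := exists_eq_add_single (y := m) (l := l) (by have := hy l; lia)
      have key : ∀ u, eval (toR u) (translate (-Pi.single l 1) P - P)
          = eval (toR (u + Pi.single l 1)) P - eval (toR u) P := fun u => by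
        rw [map_sub, eval_translate, toR_add_single, sub_neg_eq_add]
      have hm' : m' ≤ m' + Pi.single l 1 := le_self_add
      have hz : z ≤ m' := le_of_add_le_add_right hy
      have hzero := ih m' _ (totalDegree_translate_sub_le (-Pi.single l 1) l P hP)
        (fun u hu hwu => by
          rw [key, h _ (add_le_add_left hu _) (by rw [wt_add_single]; lia),
            h u (hu.trans hm') (by lia), sub_zero]) z hz
      rw [key, ihw z (hz.trans hm') (by rw [wt_add_single] at hw; lia), sub_zero] at hzero
      exact hzero

/-- The polynomial obtained from `P` by adjoining an antisymmetrized pair of unit steps in the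
directions `A` and `B`, in a box with side lengths `m`. -/
def pairStep {n : ℕ} (m : Fin n → ℕ) (A B : Fin n) (P : MvPolynomial (Fin n) ℝ) :
    MvPolynomial (Fin n) ℝ :=
  X A * (C (m B : ℝ) - X B) * translate (Pi.single A 1) P
    - (C (m A : ℝ) - X A) * X B * translate (Pi.single B 1) P

lemma totalDegree_C_mul_X_mul_le {n d : ℕ} (c : ℝ) (l : Fin n) {P : MvPolynomial (Fin n) ℝ}
    (hP : P.totalDegree ≤ d) : (C c * (X l * P)).totalDegree ≤ d + 1 := by
  have h₁ := totalDegree_mul (C c) (X l * P)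
  have h₂ := totalDegree_mul (X l) P
  rw [totalDegree_C] at h₁
  rw [totalDegree_X] at h₂
  lia

lemma totalDegree_pairStep_le {n d : ℕ} (m : Fin n → ℕ) (A B : Fin n)
    {P : MvPolynomial (Fin n) ℝ} (hP : P.totalDegree ≤ d) :
    (pairStep m A B P).totalDegree ≤ d + 1 := by
  have hsplit : pairStep m A B P =
      C (m B : ℝ) * (X A * translate (Pi.single A 1) P)
      - C (m A : ℝ) * (X B * translate (Pi.single B 1) P)
      - (C 1 * (X B * (X A * (translate (Pi.single A 1) P - P)))
        - C 1 * (X A * (X B * (translate (Pi.single B 1) P - P)))) := by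
    rw [pairStep, C_1]; ring
  rw [hsplit]
  refine (totalDegree_sub _ _).trans (max_le ((totalDegree_sub _ _).trans (max_le ?_ ?_))
    ((totalDegree_sub _ _).trans (max_le ?_ ?_)))
  · exact totalDegree_C_mul_X_mul_le _ _ ((totalDegree_translate_le _ _).trans hP)
  · exact totalDegree_C_mul_X_mul_le _ _ ((totalDegree_translate_le _ _).trans hP)
  · exact totalDegree_C_mul_X_mul_le _ _ ((totalDegree_X_mul_translate_sub_le _ _ _).trans hP)
  · exact totalDegree_C_mul_X_mul_le _ _ ((totalDegree_X_mul_translate_sub_le _ _ _).trans hP)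

lemma eval_pairStep {n : ℕ} (m : Fin n → ℕ) (A B : Fin n) (P : MvPolynomial (Fin n) ℝ)
    (y : Fin n → ℕ) :
    eval (toR y) (pairStep m A B P) =
      y A * (m B - y B) * eval (toR y - Pi.single A 1) P
        - (m A - y A) * y B * eval (toR y - Pi.single B 1) P := by
  simp [pairStep, eval_translate, toR]

lemma toR_add_single_sub {n : ℕ} (y : Fin n → ℕ) (l : Fin n) :
    toR (y + Pi.single l 1) - Pi.single l 1 = toR y := by
  rw [toR_add_single, add_sub_cancel_right]

/-- The polynomial `P` vanishes on the `i` lowest and the `i` highest layers of the box with side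
lengths `m`. -/
def VanishesOnEnds {n : ℕ} (m : Fin n → ℕ) (i : ℕ) (P : MvPolynomial (Fin n) ℝ) : Prop :=
  ∀ y ≤ m, wt y < i ∨ wt m < wt y + i → eval (toR y) P = 0

lemma half_pairStep_eq_zero {n i : ℕ} {m : Fin n → ℕ} {A B : Fin n} (hAB : A ≠ B)
    {P : MvPolynomial (Fin n) ℝ} (hP : VanishesOnEnds m i P) {y : Fin n → ℕ}
    (hy : y ≤ m + Pi.single A 1 + Pi.single B 1)
    (hw : wt y < i + 1 ∨ wt (m + Pi.single A 1 + Pi.single B 1) < wt y + (i + 1)) :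
    (y A : ℝ) * (((m + Pi.single A 1 + Pi.single B 1 : Fin n → ℕ) B : ℕ) - y B)
      * eval (toR y - Pi.single A 1) P = 0 := by
  by_cases hA : y A = 0
  · simp [hA]
  by_cases hB : y B = (m + Pi.single A 1 + Pi.single B 1 : Fin n → ℕ) B
  · simp [hB]
  obtain ⟨z, rfl⟩ := exists_eq_add_single hA
  rw [toR_add_single_sub, hP z ?_ ?_, mul_zero]
  · intro t
    have ht := hy t
    by_cases hB' : t = B
    · subst hB'
      simp [hAB.symm] at hB ht ⊢
      lia
    · by_cases hA' : t = A
      · subst hA'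
        simpa [hAB] using ht
      · simpa [hA', hB'] using ht
  · simp only [wt_add_single] at hw
    lia

lemma VanishesOnEnds.pairStep {n i : ℕ} {m : Fin n → ℕ} {A B : Fin n} (hAB : A ≠ B)
    {P : MvPolynomial (Fin n) ℝ} (hP : VanishesOnEnds m i P) :
    VanishesOnEnds (m + Pi.single A 1 + Pi.single B 1) (i + 1)
      (pairStep (m + Pi.single A 1 + Pi.single B 1) A B P) := by
  intro y hy hw
  rw [eval_pairStep, half_pairStep_eq_zero hAB hP hy hw, zero_sub, neg_eq_zero]
  rw [add_right_comm] at hy hw ⊢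
  rw [mul_comm ((_ : ℝ) - _)]
  exact half_pairStep_eq_zero hAB.symm hP hy hw

lemma sum_erase_add_single_of_ne {n : ℕ} (y : Fin n → ℕ) {l r : Fin n} (h : l ≠ r) :
    ∑ t ∈ Finset.univ.erase r, (y + Pi.single l 1 : Fin n → ℕ) t = ∑ t ∈ Finset.univ.erase r, y t + 1 := by
  simp [Finset.sum_add_distrib, h]

lemma sum_erase_add_single_self {n : ℕ} (y : Fin n → ℕ) (r : Fin n) :
    ∑ t ∈ Finset.univ.erase r, (y + Pi.single r 1 : Fin n → ℕ) t = ∑ t ∈ Finset.univ.erase r, y t := by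
  simp [Finset.sum_add_distrib]

lemma wt_eq_add_sum_erase {n : ℕ} (y : Fin n → ℕ) (r : Fin n) :
    wt y = y r + ∑ t ∈ Finset.univ.erase r, y t :=
  (Finset.add_sum_erase _ _ (Finset.mem_univ r)).symm

/-- At a point of a box all of whose coordinates but one are extreme, some polynomial of degree at
most `i` vanishing on the `i` lowest and the `i` highest layers does not vanish. -/
lemma exists_vanishesOnEnds_eval_ne_zero {n : ℕ} (r : Fin n) (i : ℕ) : ∀ m x : Fin n → ℕ, x ≤ m →
    (∀ l ≠ r, x l = 0 ∨ x l = m l) → i ≤ wt x → wt x + i ≤ wt m →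
    i ≤ ∑ l ∈ Finset.univ.erase r, m l →
    ∃ P : MvPolynomial (Fin n) ℝ, P.totalDegree ≤ i ∧ VanishesOnEnds m i P ∧
      eval (toR x) P ≠ 0 := by
  induction i with
  | zero =>
    intro m x _ _ _ _ _
    refine ⟨1, by simp, fun y hy hw => ?_, by simp⟩
    have := wt_mono hy
    lia
  | succ i ih =>
    intro m x hx hext hlow hhigh hrest
    obtain ⟨A, B, hAB, hA, hB, hflat, hsum⟩ : ∃ A B, A ≠ B ∧ x A ≠ 0 ∧ x B < m B ∧
        (x A = m A ∨ x B = 0) ∧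
        (A ≠ r → B ≠ r → i + 2 ≤ ∑ l ∈ Finset.univ.erase r, m l) := by
      have hfull : ∑ l ∈ Finset.univ.erase r, x l ≠ 0 → ∃ A ≠ r, x A ≠ 0 ∧ x A = m A := by
        intro h
        obtain ⟨A, hA, hA0⟩ := Finset.exists_ne_zero_of_sum_ne_zero h
        have hAr := Finset.ne_of_mem_erase hA
        exact ⟨A, hAr, hA0, (hext A hAr).resolve_left hA0⟩
      have hempty : ∑ l ∈ Finset.univ.erase r, x l ≠ ∑ l ∈ Finset.univ.erase r, m l →
          ∃ B ≠ r, x B < m B ∧ x B = 0 := by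
        intro h
        obtain ⟨B, hB, hB0⟩ : ∃ B ∈ Finset.univ.erase r, x B ≠ m B := by
          contrapose! h
          exact Finset.sum_congr rfl h
        have hBr := Finset.ne_of_mem_erase hB
        exact ⟨B, hBr, lt_of_le_of_ne (hx B) hB0, (hext B hBr).resolve_right hB0⟩
      rw [wt_eq_add_sum_erase x r] at hlow hhigh
      rw [wt_eq_add_sum_erase m r] at hhigh
      have hxr := hx r
      have hle : ∑ l ∈ Finset.univ.erase r, x l ≤ ∑ l ∈ Finset.univ.erase r, m l :=
        Finset.sum_le_sum fun l _ => hx l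
      by_cases h₁ : x r ≠ 0 ∧ ∑ l ∈ Finset.univ.erase r, x l ≠ ∑ l ∈ Finset.univ.erase r, m l
      · obtain ⟨B, hBr, hB, hB0⟩ := hempty h₁.2
        exact ⟨r, B, hBr.symm, h₁.1, hB, Or.inr hB0, fun h => absurd rfl h⟩
      by_cases h₂ : x r < m r ∧ ∑ l ∈ Finset.univ.erase r, x l ≠ 0
      · obtain ⟨A, hAr, hA, hAm⟩ := hfull h₂.2
        exact ⟨A, r, hAr, hA, h₂.1, Or.inl hAm, fun _ h => absurd rfl h⟩
      obtain ⟨A, hAr, hA, hAm⟩ := hfull (by lia)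
      obtain ⟨B, hBr, hB, hB0⟩ := hempty (by lia)
      exact ⟨A, B, fun h => by subst h; lia, hA, hB, Or.inl hAm, fun _ _ => by lia⟩
    obtain ⟨z, rfl⟩ := exists_eq_add_single hA
    obtain ⟨m₁, rfl⟩ := exists_eq_add_single (y := m) (l := B) (by lia)
    obtain ⟨m', rfl⟩ := exists_eq_add_single (y := m₁) (l := A) (by
      have := hx A
      simp [hAB] at this
      lia)
    have hzm : z ≤ m' := by
      intro t
      have ht := hx t
      by_cases hB' : t = B
      · subst hB'
        simp [hAB.symm] at hB ⊢
        lia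
      · by_cases hA' : t = A
        · subst hA'
          simpa [hAB] using ht
        · simpa [hA', hB'] using ht
    simp only [wt_add_single] at hlow hhigh
    obtain ⟨P, hdeg, hvan, hne⟩ := ih m' z hzm (fun l hl => by
      have h := hext l hl
      by_cases hB' : l = B
      · subst hB'
        simp [hAB.symm] at h hB
        lia
      · by_cases hA' : l = A
        · subst hA'
          simp [hAB] at h
          lia
        · simpa [hA', hB'] using h) (by lia) (by lia) (by
      by_cases hAr : A = r
      · subst hAr
        rw [sum_erase_add_single_of_ne _ hAB.symm, sum_erase_add_single_self] at hrest
        lia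
      · by_cases hBr : B = r
        · subst hBr
          rw [sum_erase_add_single_self, sum_erase_add_single_of_ne _ hAB] at hrest
          lia
        · have := hsum hAr hBr
          rw [sum_erase_add_single_of_ne _ hBr, sum_erase_add_single_of_ne _ hAr] at this
          lia)
    refine ⟨_, totalDegree_pairStep_le _ A B hdeg, hvan.pairStep hAB, ?_⟩
    have hzero : (((m' + Pi.single A 1 + Pi.single B 1 : Fin n → ℕ) A : ℕ)
        - ((z + Pi.single A 1 : Fin n → ℕ) A : ℕ) : ℝ) * ((z + Pi.single A 1 : Fin n → ℕ) B : ℕ)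
        = 0 := by
      rcases hflat with h | h
      · rw [h, sub_self, zero_mul]
      · rw [h, Nat.cast_zero, mul_zero]
    rw [eval_pairStep, hzero, zero_mul, sub_zero, toR_add_single_sub]
    exact mul_ne_zero (mul_ne_zero (Nat.cast_ne_zero.2 hA)
      (sub_ne_zero.2 (Nat.cast_injective.ne hB.ne'))) hne

/-- Every layer of a box contains a point all of whose coordinates but one are extreme. -/
lemma exists_extreme_point {n : ℕ} [NeZero n] (m : Fin n → ℕ) (s : Finset (Fin n)) :
    ∀ j ≤ ∑ l ∈ s, m l, ∃ x ≤ m, (∀ l ∉ s, x l = 0) ∧ wt x = j ∧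
      ∃ r, ∀ l ≠ r, x l = 0 ∨ x l = m l := by
  induction s using Finset.induction_on with
  | empty =>
    intro j hj
    exact ⟨0, zero_le, fun _ _ => rfl, by simpa [wt, eq_comm] using hj, 0, fun _ _ => Or.inl rfl⟩
  | insert a s ha ih =>
    intro j hj
    rw [Finset.sum_insert ha] at hj
    rcases le_total j (∑ l ∈ s, m l) with h | h
    · obtain ⟨x, hx, hs, hw, hr⟩ := ih j h
      exact ⟨x, hx, fun l hl => hs l fun h' => hl (Finset.mem_insert_of_mem h'), hw, hr⟩
    · refine ⟨fun l => if l = a then j - ∑ l ∈ s, m l else if l ∈ s then m l else 0,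
        fun l => ?_, fun l hl => ?_, ?_, a, fun l hl => ?_⟩
      · dsimp only
        split_ifs with h₁ h₂
        · subst h₁; lia
        · exact le_rfl
        · exact Nat.zero_le _
      · rw [Finset.mem_insert, not_or] at hl
        simp [hl]
      · rw [wt_eq_add_sum_erase _ a]
        have : ∑ l ∈ Finset.univ.erase a,
            (if l = a then j - ∑ l ∈ s, m l else if l ∈ s then m l else 0) = ∑ l ∈ s, m l := by
          rw [Finset.sum_congr rfl fun l hl => if_neg (Finset.ne_of_mem_erase hl),
            Finset.sum_ite_mem, Finset.inter_eq_right.2]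
          exact fun l hl => Finset.mem_erase.2 ⟨fun h' => ha (h' ▸ hl), Finset.mem_univ l⟩
        rw [this, if_pos rfl]
        lia
      · simp only [if_neg hl]
        split_ifs <;> simp

lemma mem_gridSet_iff {n : ℕ} {k : Fin n → ℕ} (hk : ∀ i, 2 ≤ k i) (x : Fin n → ℕ) :
    x ∈ gridSet n k ↔ x ≤ fun l => k l - 1 :=
  forall_congr' fun l => by have := hk l; lia

lemma wt_le_Ntot {n : ℕ} {k : Fin n → ℕ} (hk : ∀ i, 2 ≤ k i) {x : Fin n → ℕ}
    (hx : x ∈ gridSet n k) : wt x ≤ Ntot n k :=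
  wt_mono ((mem_gridSet_iff hk x).1 hx)

lemma finite_layer (n : ℕ) (k : Fin n → ℕ) (j : ℕ) : (layer n k j).Finite :=
  (Set.finite_Iic k).subset fun _ hx l => (hx.1 l).le

/-- In a strictly unimodal grid no side is longer than half of the total length, rounded up. -/
lemma SU2.half_le_sum_erase {n : ℕ} {k : Fin n → ℕ} (hk : ∀ i, 2 ≤ k i) (hSU : SU2 n k)
    (r : Fin n) : Ntot n k / 2 ≤ ∑ l ∈ Finset.univ.erase r, (k l - 1) := by
  by_contra! h
  set R := ∑ l ∈ Finset.univ.erase r, (k l - 1) with hR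
  have hN : Ntot n k = (k r - 1) + R := wt_eq_add_sum_erase (fun l => k l - 1) r
  refine (hSU.1 R h).not_ge (Set.ncard_le_ncard_of_injOn (fun y => y - Pi.single r 1)
    (fun y hy => ?_) (fun y hy y' hy' heq => ?_) (finite_layer n k R))
  all_goals
    have hpos : ∀ u ∈ layer n k (R + 1), ∃ z : Fin n → ℕ, u = z + Pi.single r 1 := fun u hu =>
      exists_eq_add_single fun h0 => by
        have hw := hu.2
        rw [wt_eq_add_sum_erase u r, h0] at hw
        have : ∑ l ∈ Finset.univ.erase r, u l ≤ R :=
          Finset.sum_le_sum fun l _ => (mem_gridSet_iff hk u).1 hu.1 l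
        lia
  · obtain ⟨z, rfl⟩ := hpos y hy
    have hz : z + Pi.single r 1 - Pi.single r 1 = z := add_tsub_cancel_right _ _
    have hw := hy.2
    rw [wt_add_single] at hw
    simp only [hz]
    exact ⟨fun l => lt_of_le_of_lt (Nat.le_add_right _ _) (hy.1 l), by lia⟩
  · obtain ⟨z, rfl⟩ := hpos y hy
    obtain ⟨z', rfl⟩ := hpos y' hy'
    simpa using heq

lemma mem_T {N i j : ℕ} (hi : i ≤ N) : j ∈ T N i ↔ j ≤ N ∧ (j < i ∨ N < j + i) := by
  simp only [T, Finset.mem_union, Finset.mem_range, Finset.mem_Icc]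
  lia

/-- for an SU² grid, `Z*-cl_{G,d}(T_{N,i}) = T_{N,i}` if `i ≤ d`, and
`Z*-cl_{G,d}(T_{N,i}) = [0,N]` if `i > d`. -/
theorem stmt14 (n : ℕ) (hn : 1 ≤ n) (k : Fin n → ℕ) (hk : ∀ i, 2 ≤ k i) (hSU : SU2 n k)
    (d : ℕ) (hd : d ≤ Ntot n k) (i : ℕ) (hi : i ≤ Ntot n k) :
    (i ≤ d → Zstar n k d (T (Ntot n k) i) = ↑(T (Ntot n k) i)) ∧
    (d < i → Zstar n k d (T (Ntot n k) i) = ↑(Finset.range (Ntot n k + 1))) := by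
  constructor
  · intro hid
    ext j
    rw [Finset.mem_coe]
    refine ⟨fun ⟨hjN, hj⟩ => ?_, fun hj => ⟨((mem_T hi).1 hj).1, fun x hx =>
      ⟨hx.1, fun P _ hP => hP x ⟨hx.1, hx.2.symm ▸ hj⟩⟩⟩⟩
    by_contra hjT
    rw [mem_T hi] at hjT
    have : NeZero n := ⟨by lia⟩
    obtain ⟨x, hx, -, hw, r, hr⟩ := exists_extreme_point (fun l => k l - 1) Finset.univ j hjN
    have hN : wt (fun l => k l - 1) = Ntot n k := rfl
    have hhalf := hSU.half_le_sum_erase hk r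
    obtain ⟨P, hdeg, hvan, hne⟩ := exists_vanishesOnEnds_eval_ne_zero r i _ x hx hr
      (by lia) (by lia) (by lia)
    refine hne ((hj ⟨(mem_gridSet_iff hk x).2 hx, hw⟩).2 P (hdeg.trans hid) fun y hy => ?_)
    exact hvan y ((mem_gridSet_iff hk y).1 hy.1) ((mem_T hi).1 hy.2).2
  · intro hdi
    ext j
    rw [Finset.mem_coe, Finset.mem_range, Nat.lt_succ_iff]
    refine ⟨fun hj => hj.1, fun hj => ⟨hj, fun x hx => ⟨hx.1, fun P hdeg hP => ?_⟩⟩⟩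
    refine eval_eq_zero_of_low_layers d _ P hdeg (fun y hy hw => ?_) x
      ((mem_gridSet_iff hk x).1 hx.1)
    have hy' := (mem_gridSet_iff hk y).2 hy
    exact hP y ⟨hy', (mem_T hi).2 ⟨wt_le_Ntot hk hy', Or.inl (by lia)⟩⟩

end CoveringSymmetric
end
end
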